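/- Let P_1 and P_0 be finite-dimensional projective A-modules and let f : P_1 → P_0 be a homomorphism with rank(f) = r(P_1,P_0). If P is a direct summand of P_1 with P ⊆ Ker(f), then Hom_A(P, Coker(f)) = 0. -/

import Mathlib

/-- The rank of an `A`-linear map between modules over a `K`-algebra `A`:
the `K`-dimension of its image. -/
noncomputable def rk (K : Type*) [Field K] {A : Type*} [Ring A] [Algebra K A]
    {M N : Type*} [AddCommGroup M] [Module A M]
    [AddCommGroup N] [Module A N] [Module K N] [IsScalarTower K A N]
    (f : M →ₗ[A] N) : ℕ :=
  Module.finrank K ((LinearMap.range f).restrictScalars K)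

/-- `rmax K A M N` is `r(M,N)`, the maximal rank of an `A`-linear map `M → N`. -/
noncomputable def rmax (K : Type*) [Field K] (A : Type*) [Ring A] [Algebra K A]
    (M N : Type*) [AddCommGroup M] [Module A M]
    [AddCommGroup N] [Module A N] [Module K N] [IsScalarTower K A N] : ℕ :=
  sSup {n : ℕ | ∃ f : M →ₗ[A] N, rk K f = n}

/-- `U` is a direct summand of `P`: it has a complementary submodule. -/
def IsDirectSummand {A P : Type*} [Ring A] [AddCommGroup P] [Module A P]
    (U : Submodule A P) : Prop :=
  ∃ V : Submodule A P, IsCompl U V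

theorem bddAbove_rk (K A M N : Type*) [Field K] [Ring A] [Algebra K A]
    [AddCommGroup M] [Module A M] [AddCommGroup N] [Module A N] [Module K N]
    [IsScalarTower K A N] [FiniteDimensional K N] :
    BddAbove {n : ℕ | ∃ f : M →ₗ[A] N, rk K f = n} := by
  refine ⟨Module.finrank K N, ?_⟩
  rintro _ ⟨f, rfl⟩
  exact Submodule.finrank_le _

theorem rk_le_rmax {K A M N : Type*} [Field K] [Ring A] [Algebra K A]
    [AddCommGroup M] [Module A M] [AddCommGroup N] [Module A N] [Module K N]
    [IsScalarTower K A N] [FiniteDimensional K N] (f : M →ₗ[A] N) :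
    rk K f ≤ rmax K A M N :=
  le_csSup (bddAbove_rk K A M N) ⟨f, rfl⟩

theorem range_eq_of_le_of_rk_eq_rmax {K A M N : Type*} [Field K] [Ring A] [Algebra K A]
    [AddCommGroup M] [Module A M] [AddCommGroup N] [Module A N] [Module K N]
    [IsScalarTower K A N] [FiniteDimensional K N] {f g : M →ₗ[A] N}
    (hf : rk K f = rmax K A M N) (hfg : LinearMap.range f ≤ LinearMap.range g) :
    LinearMap.range f = LinearMap.range g :=
  Submodule.restrictScalars_injective K A N <|
    Submodule.eq_of_le_of_finrank_le hfg ((rk_le_rmax g).trans_eq hf.symm)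

theorem stmt5 {K A : Type*} [Field K] [IsAlgClosed K] [Ring A] [Algebra K A]
    [FiniteDimensional K A]
    {P₁ P₀ : Type*}
    [AddCommGroup P₁] [Module A P₁] [Module K P₁] [IsScalarTower K A P₁] [FiniteDimensional K P₁]
    [AddCommGroup P₀] [Module A P₀] [Module K P₀] [IsScalarTower K A P₀] [FiniteDimensional K P₀]
    (hP₁proj : Module.Projective A P₁) (hP₀proj : Module.Projective A P₀)
    (f : P₁ →ₗ[A] P₀) (hf : rk K f = rmax K A P₁ P₀)
    (P : Submodule A P₁) (hP : IsDirectSummand P) (hPker : P ≤ LinearMap.ker f)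
    (φ : P →ₗ[A] (P₀ ⧸ LinearMap.range f)) :
    φ = 0 := by
  obtain ⟨V, hV⟩ := hP
  let π : P₁ →ₗ[A] P := P.projectionOnto V hV
  have hπ (p : P) : π p = p := Submodule.projectionOnto_apply_left hV p
  have : Module.Projective A P := Module.Projective.of_split P.subtype π (LinearMap.ext hπ)
  obtain ⟨ψ, hψ⟩ := Module.projective_lifting_property (LinearMap.range f).mkQ φ
    (Submodule.mkQ_surjective _)
  have hrange : LinearMap.range f = LinearMap.range (f + ψ ∘ₗ π) := by
    refine range_eq_of_le_of_rk_eq_rmax hf ?_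
    rintro _ ⟨x, rfl⟩
    refine ⟨x - π x, ?_⟩
    have hker : f (π x) = 0 := hPker (π x).2
    simp [hπ, hker]
  ext p
  have hker : f p = 0 := hPker p.2
  have hmem : ψ p ∈ LinearMap.range f := by
    rw [hrange]
    exact ⟨p, by simp [hπ, hker]⟩
  rw [← hψ]
  simpa using hmem
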